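/- Let n and k be positive integers, let K, Z, H be real n×n matrices such that M := K H Kᵀ is positive definite, and let β be a real n×k matrix satisfying the constraint βᵀ M β = I_k (the k×k identity matrix). Let M^{-1/2} denote the positive semidefinite square root of M⁻¹ and set σ := ‖M^{-1/2}‖_F². Then ‖βᵀ K Z Kᵀ β‖_F² ≤ σ · k · ‖βᵀ K Z Kᵀ‖_F². -/

import Mathlib

open Matrix

/-- Squared Frobenius norm of a real matrix: `‖X‖_F² = tr (Xᵀ X)`. -/
noncomputable def frobSq {m p : Type*} [Fintype m] [Fintype p] (X : Matrix m p ℝ) : ℝ :=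
  Matrix.trace (Xᵀ * X)

theorem frobSq_eq_sum {m p : Type*} [Fintype m] [Fintype p] (X : Matrix m p ℝ) :
    frobSq X = ∑ j, ∑ i, X i j ^ 2 := by
  simp only [frobSq, Matrix.trace, Matrix.diag, Matrix.mul_apply, Matrix.transpose_apply, sq]

theorem frobSq_nonneg {m p : Type*} [Fintype m] [Fintype p] (X : Matrix m p ℝ) :
    0 ≤ frobSq X := by
  rw [frobSq_eq_sum]
  positivity

/-- The squared Frobenius norm is submultiplicative. -/
theorem frobSq_mul_le {l m p : Type*} [Fintype l] [Fintype m] [Fintype p]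
    (X : Matrix l m ℝ) (Y : Matrix m p ℝ) : frobSq (X * Y) ≤ frobSq X * frobSq Y := by
  simp only [frobSq_eq_sum, Matrix.mul_apply]
  rw [Finset.sum_comm (f := fun j i => X i j ^ 2), Finset.mul_sum]
  refine Finset.sum_le_sum fun j _ => ?_
  rw [Finset.sum_mul]
  exact Finset.sum_le_sum fun i _ => Finset.sum_mul_sq_le_sq_mul_sq _ _ _

/-- **Theorem 1.** If `M := K H Kᵀ` is positive definite and `βᵀ M β = I_k`, then with
`S = M^{-1/2}` (the positive semidefinite square root of `M⁻¹`) and `σ = ‖S‖_F²`, we have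
`‖βᵀ K Z Kᵀ β‖_F² ≤ σ k ‖βᵀ K Z Kᵀ‖_F²`. -/
theorem stmt0 (n k : ℕ) (hn : 0 < n) (hk : 0 < k)
    (K Z H : Matrix (Fin n) (Fin n) ℝ)
    (hM : (K * H * Kᵀ).PosDef)
    (β : Matrix (Fin n) (Fin k) ℝ)
    (hβ : βᵀ * (K * H * Kᵀ) * β = 1)
    (S : Matrix (Fin n) (Fin n) ℝ)
    (hS : S.PosSemidef) (hSsq : S * S = (K * H * Kᵀ)⁻¹) :
    frobSq (βᵀ * K * Z * Kᵀ * β) ≤ frobSq S * (k : ℝ) * frobSq (βᵀ * K * Z * Kᵀ) := by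
  have hdetM : IsUnit (K * H * Kᵀ).det := hM.det_pos.ne'.isUnit
  have hdetS : IsUnit S.det := by
    have h : IsUnit (S * S).det := by
      rw [hSsq]
      exact Matrix.isUnit_nonsing_inv_det _ hdetM
    rw [Matrix.det_mul] at h
    exact isUnit_of_mul_isUnit_left h
  have hST : Sᵀ = S := by
    simpa [Matrix.IsHermitian, Matrix.conjTranspose_eq_transpose_of_trivial] using hS.isHermitian
  have hSinv : S⁻¹ * S⁻¹ = K * H * Kᵀ := by
    rw [← Matrix.mul_inv_rev, hSsq, Matrix.nonsing_inv_nonsing_inv _ hdetM]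
  have hwhite : frobSq (S⁻¹ * β) = k := by
    have h : (S⁻¹ * β)ᵀ * (S⁻¹ * β) = 1 := by
      rw [Matrix.transpose_mul, Matrix.transpose_nonsing_inv, hST, ← hβ, ← hSinv]
      simp only [Matrix.mul_assoc]
    rw [frobSq, h, Matrix.trace_one, Fintype.card_fin]
  have hβ_le : frobSq β ≤ frobSq S * k := by
    have h := frobSq_mul_le S (S⁻¹ * β)
    rwa [Matrix.mul_nonsing_inv_cancel_left _ _ hdetS, hwhite] at h
  calc frobSq (βᵀ * K * Z * Kᵀ * β) ≤ frobSq (βᵀ * K * Z * Kᵀ) * frobSq β := frobSq_mul_le _ _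
    _ ≤ frobSq (βᵀ * K * Z * Kᵀ) * (frobSq S * k) :=
      mul_le_mul_of_nonneg_left hβ_le (frobSq_nonneg _)
    _ = frobSq S * (k : ℝ) * frobSq (βᵀ * K * Z * Kᵀ) := mul_comm _ _
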